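/- arXiv:2604.00054 — 2 statements merged into one kernel-verified Lean document; each statement's English description precedes it below -/
import Mathlib

section
/- Let b be a prime and m = b². Then Σ_χ |L(1,χ)|²·|S_G(χ)|² = (π²·φ(m)/b²)·Σ_a |S°(a)|², where the left sum runs over all primitive odd Dirichlet characters χ modulo m and the right sum runs over all a ∈ {0,…,m−1} with gcd(a,m) = 1. -/
open Finset
open scoped Classical

namespace Collision

/-- The diagonal set `G = {n < b² : ⌊n/b⌋ = n mod b}`. -/
def diagSet (b : ℕ) : Finset ℕ :=
  (Finset.range (b ^ 2)).filter (fun n => n / b = n % b)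

/-- The slice increment `d_n(a) = ⌊(n+1)a/b²⌋ − ⌊na/b²⌋`. -/
def d (b n a : ℕ) : ℤ :=
  ((((n + 1) * a) / b ^ 2 : ℕ) : ℤ) - (((n * a) / b ^ 2 : ℕ) : ℤ)

/-- The collision invariant `S(a) = −1 − ⌊a/b⌋ + Σ_{n∈G} d_n(a)`. -/
def S (b a : ℕ) : ℤ :=
  -1 - ((a / b : ℕ) : ℤ) + ∑ n ∈ diagSet b, d b n a

/-- The units `a' ∈ {0,…,b²−1}` with `a' ≡ a (mod b)`. -/
def cosetUnits (b a : ℕ) : Finset ℕ :=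
  (Finset.range (b ^ 2)).filter (fun a' => Nat.gcd a' (b ^ 2) = 1 ∧ a' % b = a % b)

/-- The centered collision invariant `S°(a)`. -/
noncomputable def Scirc (b a : ℕ) : ℝ :=
  (S b a : ℝ) - (1 / (b : ℝ)) * ∑ a' ∈ cosetUnits b a, (S b a' : ℝ)

/-- The Fourier coefficient `Ŝ°(χ) = (1/φ(b²))·Σ_a S°(a)·χ̄(a)`. -/
noncomputable def Shat (b : ℕ) (χ : DirichletCharacter ℂ (b ^ 2)) : ℂ :=
  (1 / (Nat.totient (b ^ 2) : ℂ)) *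
    ∑ a ∈ Finset.range (b ^ 2), (Scirc b a : ℂ) * starRingEnd ℂ (χ (a : ZMod (b ^ 2)))

/-- The generalized first Bernoulli number `B_{1,χ̄} = (1/b²)·Σ_a a·χ̄(a)`. -/
noncomputable def B1bar (b : ℕ) (χ : DirichletCharacter ℂ (b ^ 2)) : ℂ :=
  (1 / ((b : ℂ) ^ 2)) *
    ∑ a ∈ Finset.range (b ^ 2), (a : ℂ) * starRingEnd ℂ (χ (a : ZMod (b ^ 2)))

/-- The diagonal character sum `S_G(χ) = Σ_{n∈G} [χ̄(n+1) − χ̄(n)]`. -/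
noncomputable def SG (b : ℕ) (χ : DirichletCharacter ℂ (b ^ 2)) : ℂ :=
  ∑ n ∈ diagSet b,
    (starRingEnd ℂ (χ ((n + 1 : ℕ) : ZMod (b ^ 2))) - starRingEnd ℂ (χ (n : ZMod (b ^ 2))))

end Collision

open MeasureTheory Filter Topology Asymptotics in
/-- On the unit circle away from `1`, the exponential zeta function at `s = 1` is a logarithm. -/
theorem HurwitzZeta.expZeta_one_eq_neg_log {x : ℝ}
    (hx : Complex.exp (2 * Real.pi * Complex.I * x) ≠ 1) :
    HurwitzZeta.expZeta x 1 = -Complex.log (1 - Complex.exp (2 * Real.pi * Complex.I * x)) := by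
  set w := Complex.exp (2 * Real.pi * Complex.I * x) with hw
  have hw1 : ‖w‖ = 1 := by
    rw [hw, Complex.norm_exp]
    simp
  have hxc : ((x : ℝ) : UnitAddCircle) ≠ 0 := by
    intro h
    obtain ⟨n, hn⟩ := (AddCircle.coe_eq_zero_iff (1 : ℝ)).1 h
    apply hx
    rw [hw, Complex.exp_eq_one_iff]
    refine ⟨n, ?_⟩
    rw [← hn]
    push_cast [zsmul_eq_mul]
    ring
  let z : ℝ → ℂ := fun t ↦ w * Real.exp (-t)
  have hz0 : z 0 = w := by simp [z]
  have hzn (t : ℝ) : ‖z t‖ = Real.exp (-t) := by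
    simp only [z, norm_mul, hw1, one_mul, Complex.norm_real, Real.norm_eq_abs, Real.abs_exp]
  have hzle {t : ℝ} (ht : 0 ≤ t) : ‖z t‖ ≤ 1 := by
    rw [hzn]; exact Real.exp_le_one_iff.2 (by linarith)
  have hzlt {t : ℝ} (ht : 0 < t) : ‖z t‖ < 1 := by
    rw [hzn]; exact Real.exp_lt_one_iff.2 (by linarith)
  have hzne {t : ℝ} (ht : 0 ≤ t) : z t ≠ 1 := by
    rcases ht.eq_or_lt with rfl | h
    · rwa [hz0]
    · intro h1
      have := hzlt h
      rw [h1] at this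
      simp at this
  have hslit {t : ℝ} (ht : 0 ≤ t) : 1 - z t ∈ Complex.slitPlane := by
    left
    have h1 := hzle ht
    have h2 : (z t).re < 1 := by
      refine lt_of_le_of_ne ((Complex.re_le_norm _).trans h1) fun h3 ↦ hzne ht ?_
      have h4 : (z t).im = 0 := by
        have h5 : (z t).re ^ 2 + (z t).im ^ 2 ≤ 1 := by
          rw [pow_two, pow_two, ← Complex.normSq_apply, ← Complex.sq_norm]
          nlinarith [norm_nonneg (z t)]
        rw [h3] at h5
        nlinarith [sq_nonneg (z t).im]
      exact Complex.ext (by simp [h3]) (by simp [h4])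
    simp only [Complex.sub_re, Complex.one_re]
    linarith
  have hzc : Continuous z := by fun_prop
  have hderiv (t : ℝ) : HasDerivAt z (-z t) t := by
    have h1 : HasDerivAt (fun t : ℝ ↦ Real.exp (-t)) (-Real.exp (-t)) t := by
      simpa using (hasDerivAt_neg t).exp
    have := h1.ofReal_comp.const_mul w
    simpa [z] using this
  let F : ℝ → ℂ := fun t ↦ z t / (1 - z t)
  have hFc {t : ℝ} (ht : 0 ≤ t) : ContinuousAt F t :=
    hzc.continuousAt.div (continuousAt_const.sub hzc.continuousAt)
      (sub_ne_zero.2 (hzne ht).symm)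
  have hFli : LocallyIntegrableOn F (Set.Ioi 0) :=
    (continuousOn_of_forall_continuousAt fun t ht ↦ hFc (le_of_lt ht)).locallyIntegrableOn
      measurableSet_Ioi
  have hztop : Tendsto z atTop (𝓝 0) := by
    have : Tendsto (fun t : ℝ ↦ ‖z t‖) atTop (𝓝 0) := by
      simp only [hzn]
      exact Real.tendsto_exp_neg_atTop_nhds_zero
    exact tendsto_zero_iff_norm_tendsto_zero.2 this
  have hFtop : F =O[atTop] fun t ↦ Real.exp (-1 * t) := by
    have h1 : z =O[atTop] fun t ↦ Real.exp (-1 * t) := by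
      refine isBigO_of_le _ fun t ↦ ?_
      rw [hzn]
      simp
    have h2 : (fun t ↦ (1 - z t)⁻¹) =O[atTop] fun _ ↦ (1 : ℝ) := by
      have : Tendsto (fun t ↦ (1 - z t)⁻¹) atTop (𝓝 (1 - 0)⁻¹) :=
        (tendsto_const_nhds.sub hztop).inv₀ (by simp)
      exact this.isBigO_one ℝ
    simpa [F, div_eq_mul_inv] using h1.mul h2
  have hFbot : F =O[𝓝[>] 0] fun t : ℝ ↦ t ^ (-(0 : ℝ)) := by
    simp only [neg_zero, Real.rpow_zero]
    exact ((hFc le_rfl).tendsto.mono_left nhdsWithin_le_nhds).isBigO_one ℝ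
  have hmell {s : ℂ} (hs : 1 < s.re) :
      Complex.Gamma s * HurwitzZeta.expZeta x s = mellin F s := by
    have hs0 : s ≠ 0 := Complex.ne_zero_of_one_lt_re hs
    have h1 : HasSum (fun n : ℕ ↦ Complex.Gamma s * w ^ (n + 1) / (((n + 1 : ℕ) : ℝ) : ℂ) ^ s)
        (mellin F s) := by
      refine hasSum_mellin (fun n ↦ Or.inr (by positivity)) (by linarith) ?_ ?_
      · intro t ht
        have h2 := (hasSum_geometric_of_norm_lt_one (hzlt ht)).mul_left (z t)
        simp only [F, div_eq_mul_inv]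
        convert! h2 using 2 with n
        simp only [z]
        rw [← pow_succ', mul_pow, ← Complex.ofReal_pow, ← Real.exp_nat_mul]
        congr 3
        push_cast
        ring
      · have := (summable_nat_add_iff 1).2 (Real.summable_one_div_nat_rpow.2 hs)
        simpa [hw1] using this
    have h3 := HurwitzZeta.hasSum_expZeta_of_one_lt_re x hs
    rw [← hasSum_nat_add_iff' 1] at h3
    have h4 := h3.mul_left (Complex.Gamma s)
    simp only [sum_range_one, Nat.cast_zero, Complex.zero_cpow hs0, div_zero, sub_zero] at h4
    refine h4.unique ?_
    convert! h1 using 2 with n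
    rw [mul_div_assoc, hw, ← Complex.exp_nat_mul]
    congr 3
    · push_cast; ring_nf
  have hmell1 : Complex.Gamma 1 * HurwitzZeta.expZeta x 1 = mellin F 1 := by
    let U : Set ℂ := {s | 0 < s.re}
    have hUo : IsOpen U := isOpen_lt continuous_const Complex.continuous_re
    have hUc : IsPreconnected U := (convex_halfSpace_re_gt 0).isPreconnected
    have ha : AnalyticOnNhd ℂ (fun s ↦ Complex.Gamma s * HurwitzZeta.expZeta x s) U := by
      refine DifferentiableOn.analyticOnNhd (fun s hs ↦ ?_) hUo
      refine ((Complex.differentiableAt_Gamma s fun m hm ↦ ?_).mul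
        (HurwitzZeta.differentiableAt_expZeta _ _ (Or.inr hxc))).differentiableWithinAt
      have h5 : 0 < s.re := hs
      rw [hm] at h5
      simp only [Complex.neg_re, Complex.natCast_re] at h5
      have : (0 : ℝ) ≤ m := m.cast_nonneg
      linarith
    have hb : AnalyticOnNhd ℂ (mellin F) U := by
      refine DifferentiableOn.analyticOnNhd (fun s hs ↦ ?_) hUo
      exact (mellin_differentiableAt_of_isBigO_rpow_exp one_pos hFli hFtop hFbot
        hs).differentiableWithinAt
    have h2 : (2 : ℂ) ∈ U := by simp [U]
    have h1 : (1 : ℂ) ∈ U := by simp [U]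
    refine ha.eqOn_of_preconnected_of_eventuallyEq hb hUc h2 ?_ h1
    have hV : {s : ℂ | 1 < s.re} ∈ 𝓝 (2 : ℂ) :=
      (isOpen_lt continuous_const Complex.continuous_re).mem_nhds (by simp)
    filter_upwards [hV] with s hs using hmell hs
  have hint : IntegrableOn F (Set.Ioi 0) := by
    have := mellinConvergent_of_isBigO_rpow_exp (s := 1) one_pos hFli hFtop hFbot (by simp)
    simpa [MellinConvergent] using this
  have hFTC : ∫ t in Set.Ioi (0 : ℝ), F t = 0 - Complex.log (1 - z 0) := by
    refine integral_Ioi_of_hasDerivAt_of_tendsto' (f := fun t ↦ Complex.log (1 - z t))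
      (fun t ht ↦ ?_) hint ?_
    · have := ((hderiv t).const_sub 1).clog_real (hslit ht)
      simpa [F] using this
    · have h1 : Tendsto (fun t ↦ 1 - z t) atTop (𝓝 1) := by
        simpa using tendsto_const_nhds (x := (1 : ℂ)) |>.sub hztop
      have := (continuousAt_clog Complex.one_mem_slitPlane).tendsto.comp h1
      simpa [Function.comp_def] using this
  rw [Complex.Gamma_one, one_mul] at hmell1
  rw [hmell1]
  simp only [mellin, sub_self, Complex.cpow_zero, one_smul]
  rw [hFTC, hz0, zero_sub]

theorem HurwitzZeta.sinZeta_one {x : ℝ} (hx : x ∈ Set.Ioo (0 : ℝ) 1) :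
    HurwitzZeta.sinZeta x 1 = Real.pi * (1 / 2 - x) := by
  obtain ⟨hx0, hx1⟩ := hx
  have hpi := Real.pi_pos
  have key {y : ℝ} (hy0 : 0 < y) (hy1 : y < 1) :
      Complex.exp (2 * Real.pi * Complex.I * y) ≠ 1 ∧
      Complex.log (1 - Complex.exp (2 * Real.pi * Complex.I * y)) =
        Real.log (2 * Real.sin (Real.pi * y)) + (Real.pi * (y - 1 / 2) : ℝ) * Complex.I := by
    have hs : 0 < 2 * Real.sin (Real.pi * y) := by
      have := Real.sin_pos_of_pos_of_lt_pi (mul_pos hpi hy0) (by nlinarith)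
      linarith
    have h1 : 1 - Complex.exp (2 * Real.pi * Complex.I * y) =
        Complex.exp (Real.log (2 * Real.sin (Real.pi * y)) +
          (Real.pi * (y - 1 / 2) : ℝ) * Complex.I) := by
      rw [Complex.exp_add, ← Complex.ofReal_exp, Real.exp_log hs, Complex.exp_mul_I,
        ← Complex.ofReal_cos, ← Complex.ofReal_sin,
        show Real.pi * (y - 1 / 2) = Real.pi * y - Real.pi / 2 by ring,
        Real.cos_sub_pi_div_two, Real.sin_sub_pi_div_two,
        show 2 * Real.pi * Complex.I * y = ((2 * (Real.pi * y) : ℝ) : ℂ) * Complex.I by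
          push_cast; ring, Complex.exp_mul_I, ← Complex.ofReal_cos, ← Complex.ofReal_sin,
        Real.cos_two_mul, Real.sin_two_mul]
      have := Real.sin_sq_add_cos_sq (Real.pi * y)
      have h' : ((Real.sin (Real.pi * y) : ℂ)) ^ 2 + (Real.cos (Real.pi * y) : ℂ) ^ 2 = 1 := by
        exact_mod_cast this
      push_cast at h' ⊢
      linear_combination (-2) * h'
    constructor
    · intro h
      rw [h, sub_self] at h1
      exact Complex.exp_ne_zero _ h1.symm
    · rw [h1, Complex.log_exp]
      · simp only [Complex.add_im, Complex.ofReal_im, Complex.mul_im, Complex.ofReal_re,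
          Complex.I_im, Complex.I_re]
        nlinarith
      · simp only [Complex.add_im, Complex.ofReal_im, Complex.mul_im, Complex.ofReal_re,
          Complex.I_im, Complex.I_re]
        nlinarith
  have hneg : (-(x : UnitAddCircle)) = ((1 - x : ℝ) : UnitAddCircle) := by
    rw [AddCircle.coe_sub, AddCircle.coe_period, zero_sub]
  obtain ⟨h1, h2⟩ := key hx0 hx1
  obtain ⟨h3, h4⟩ := key (y := 1 - x) (by linarith) (by linarith)
  rw [HurwitzZeta.sinZeta_eq, hneg, expZeta_one_eq_neg_log h1, expZeta_one_eq_neg_log h3, h2, h4,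
    show Real.pi * (1 - x) = Real.pi - Real.pi * x by ring, Real.sin_pi_sub]
  have := Complex.I_ne_zero
  field_simp
  push_cast
  ring

namespace DirichletCharacter

variable {N : ℕ}

theorem IsPrimitive.inv {χ : DirichletCharacter ℂ N} (hχ : χ.IsPrimitive) : χ⁻¹.IsPrimitive := by
  rw [isPrimitive_def, conductor_inv]
  exact hχ

theorem Odd.ne_one {χ : DirichletCharacter ℂ N} (hχ : χ.Odd) : χ ≠ 1 := by
  rintro rfl
  have h : (1 : DirichletCharacter ℂ N) (-1) = -1 := hχ
  rw [MulChar.one_apply isUnit_one.neg] at h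
  norm_num at h

theorem Odd.modulus_ne_one {χ : DirichletCharacter ℂ N} (hχ : χ.Odd) : N ≠ 1 :=
  fun h ↦ hχ.ne_one (level_one' χ h)

variable [NeZero N]

open ZMod in
theorem IsPrimitive.gaussSum_mul_gaussSum_inv {χ : DirichletCharacter ℂ N} (hχ : χ.IsPrimitive) :
    gaussSum χ stdAddChar * gaussSum χ⁻¹ stdAddChar = N * χ (-1) := by
  have h := congrFun (dft_dft (χ : ZMod N → ℂ)) 1
  simp only [smul_eq_mul] at h
  rw [← h, dft_apply]
  simp only [hχ.fourierTransform_eq_inv_mul_gaussSum, smul_eq_mul, mul_one]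
  rw [Fintype.sum_equiv (Equiv.neg (ZMod N)) _
    (fun j ↦ gaussSum χ stdAddChar * (χ⁻¹ j * stdAddChar j)) (fun j ↦ by
      rw [Equiv.neg_apply]; ring), ← mul_sum]
  rfl

open ZMod in
theorem IsPrimitive.norm_gaussSum_sq {χ : DirichletCharacter ℂ N} (hχ : χ.IsPrimitive) :
    ‖gaussSum χ stdAddChar‖ ^ 2 = N := by
  have h1 : star (gaussSum χ stdAddChar) = χ (-1) * gaussSum χ⁻¹ stdAddChar := by
    rw [star_gaussSum_eq, AddChar.inv_mulShift, gaussSum_mulShift_of_isPrimitive _ hχ.inv,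
      inv_inv]
  have h2 := hχ.gaussSum_mul_gaussSum_inv
  have h3 : (χ (-1)) * χ (-1) = 1 := by rw [← map_mul]; simp
  have h4 : ((‖gaussSum χ stdAddChar‖ ^ 2 : ℝ) : ℂ) = N := by
    rw [Complex.ofReal_pow, ← Complex.mul_conj', starRingEnd_apply, h1]
    linear_combination χ (-1) * h2 + N * h3
  exact_mod_cast h4

/-- The first moment `∑ j, j χ⁻¹(j)` over the residues `0 ≤ j < N`. -/
noncomputable def firstMoment (χ : DirichletCharacter ℂ N) : ℂ :=
  ∑ j : ZMod N, (j.val : ℂ) * χ⁻¹ j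

open ZMod HurwitzZeta in
theorem IsPrimitive.gaussSum_mul_LFunction_one {χ : DirichletCharacter ℂ N} (hχ : χ.IsPrimitive)
    (hodd : χ.Odd) :
    gaussSum χ⁻¹ stdAddChar * LFunction χ 1 = -(Real.pi * Complex.I / N) * firstMoment χ := by
  have hN : (N : ℂ) ≠ 0 := NeZero.ne _
  have hodd' : χ⁻¹.Odd := by
    have h : χ (-1) = -1 := hodd
    change χ⁻¹ (-1) = -1
    rw [← MulChar.star_apply', h]
    simp
  have h0 : χ⁻¹ 0 = 0 := map_zero' _ hodd.modulus_ne_one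
  have h1 := LFunction_dft ⇑(χ⁻¹) (s := 1) (Or.inl h0)
  have h2 : ZMod.LFunction (𝓕 ⇑(χ⁻¹)) 1 =
      -(gaussSum χ⁻¹ stdAddChar * LFunction χ 1) := by
    have : 𝓕 ⇑(χ⁻¹) = fun k ↦ -gaussSum χ⁻¹ stdAddChar * χ k := by
      ext k
      rw [hχ.inv.fourierTransform_eq_inv_mul_gaussSum, inv_inv, hodd.eval_neg]
      ring
    rw [this, DirichletCharacter.LFunction, ZMod.LFunction, ZMod.LFunction]
    simp only [mul_sum, ← sum_neg_distrib]
    exact sum_congr rfl fun j _ ↦ by ring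
  rw [h2] at h1
  have h3 : ∑ j : ZMod N, χ⁻¹ j * expZeta (toAddCircle (-j)) 1 =
      -∑ j : ZMod N, χ⁻¹ j * expZeta (toAddCircle j) 1 := by
    rw [← sum_neg_distrib]
    refine Fintype.sum_equiv (Equiv.neg _) _ _ fun j ↦ ?_
    rw [Equiv.neg_apply, hodd'.eval_neg]
    ring
  have h4 : ∑ j : ZMod N, χ⁻¹ j * expZeta (toAddCircle (-j)) 1 =
      -Complex.I * ∑ j : ZMod N, χ⁻¹ j * sinZeta (toAddCircle j) 1 := by
    have h5 : ∑ j : ZMod N, χ⁻¹ j * sinZeta (toAddCircle j) 1 =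
        (∑ j : ZMod N, χ⁻¹ j * expZeta (toAddCircle j) 1 -
          ∑ j : ZMod N, χ⁻¹ j * expZeta (toAddCircle (-j)) 1) / (2 * Complex.I) := by
      rw [← sum_sub_distrib, sum_div]
      refine sum_congr rfl fun j _ ↦ ?_
      rw [sinZeta_eq, map_neg]
      ring
    rw [h5, h3]
    have := Complex.I_ne_zero
    field_simp
    ring
  have h6 : ∑ j : ZMod N, χ⁻¹ j * sinZeta (toAddCircle j) 1 =
      -(Real.pi / N) * firstMoment χ := by
    have h7 (j : ZMod N) : χ⁻¹ j * sinZeta (toAddCircle j) 1 =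
        Real.pi / 2 * χ⁻¹ j + -(Real.pi / N) * (j.val * χ⁻¹ j) := by
      rcases eq_or_ne j 0 with rfl | hj
      · simp [h0]
      · have hNr : (0 : ℝ) < N := Nat.cast_pos.2 (NeZero.pos N)
        have hv : 0 < j.val := Nat.pos_of_ne_zero ((ZMod.val_ne_zero j).2 hj)
        rw [toAddCircle_apply, sinZeta_one ⟨by positivity, (div_lt_one hNr).2
          (Nat.cast_lt.2 j.val_lt)⟩]
        push_cast
        field_simp
        ring
    rw [sum_congr rfl fun j _ ↦ h7 j, sum_add_distrib, ← mul_sum, ← mul_sum,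
      MulChar.sum_eq_zero_of_ne_one (inv_ne_one.2 hodd.ne_one), firstMoment]
    ring
  rw [h4, h6] at h1
  linear_combination -h1

theorem IsPrimitive.norm_LFunction_one_sq {χ : DirichletCharacter ℂ N} (hχ : χ.IsPrimitive)
    (hodd : χ.Odd) :
    ‖LFunction χ 1‖ ^ 2 = Real.pi ^ 2 / N ^ 3 * ‖firstMoment χ‖ ^ 2 := by
  have hNr : (0 : ℝ) < N := Nat.cast_pos.2 (NeZero.pos N)
  have h := congrArg (‖·‖ ^ 2) (hχ.gaussSum_mul_LFunction_one hodd)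
  simp only [norm_mul, norm_neg, norm_div, mul_pow, div_pow, hχ.inv.norm_gaussSum_sq,
    Complex.norm_I, Complex.norm_natCast, Complex.norm_real, Real.norm_eq_abs, sq_abs, mul_one] at h
  field_simp at h ⊢
  linear_combination h

/-- Twisted sums of a dilated function against a primitive character pick out the value of the
character at the dilation, including at non-units. -/
theorem IsPrimitive.sum_mul_inv_apply {χ : DirichletCharacter ℂ N} (hχ : χ.IsPrimitive)
    (g : ZMod N → ℂ) (n : ZMod N) :
    ∑ j, g (n * j) * χ⁻¹ j = χ n * ∑ j, g j * χ⁻¹ j := by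
  have h (n : ZMod N) : ∑ j, g (n * j) * χ⁻¹ j =
      (N : ℂ)⁻¹ * ∑ k, ZMod.dft g k *
        gaussSum χ⁻¹ ((ZMod.stdAddChar.mulShift k).mulShift n) := by
    have hg (x : ZMod N) : g x = (N : ℂ)⁻¹ * ∑ k, ZMod.stdAddChar (k * x) * ZMod.dft g k := by
      conv_lhs => rw [← LinearEquiv.symm_apply_apply ZMod.dft g, ZMod.invDFT_apply]
      simp
    simp only [hg (n * _), mul_assoc, sum_mul]
    rw [← mul_sum, sum_comm]
    congr 1
    refine sum_congr rfl fun k _ ↦ ?_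
    rw [gaussSum, mul_sum]
    refine sum_congr rfl fun j _ ↦ ?_
    simp only [AddChar.mulShift_apply]
    ring
  rw [h n, show ∑ j, g j * χ⁻¹ j = ∑ j, g (1 * j) * χ⁻¹ j by simp, h 1]
  simp only [gaussSum_mulShift_of_isPrimitive _ hχ.inv, inv_inv, map_one, one_mul, mul_sum]
  exact sum_congr rfl fun j _ ↦ by ring

theorem Even.firstMoment_eq_zero {χ : DirichletCharacter ℂ N} (heven : χ.Even) (hχ : χ ≠ 1) :
    firstMoment χ = 0 := by
  have hN : N ≠ 1 := fun h ↦ hχ (level_one' χ h)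
  have heven' : χ⁻¹.Even := by
    have h : χ (-1) = 1 := heven
    change χ⁻¹ (-1) = 1
    rw [← MulChar.star_apply', h]
    simp
  have h1 : firstMoment χ = ∑ j : ZMod N, ((N : ℂ) * χ⁻¹ j - j.val * χ⁻¹ j) := by
    rw [firstMoment]
    refine Fintype.sum_equiv (Equiv.neg _) _ _ fun j ↦ ?_
    rw [Equiv.neg_apply, heven'.eval_neg]
    rcases eq_or_ne j 0 with rfl | hj
    · simp [map_zero' χ⁻¹ hN]
    · have : NeZero j := ⟨hj⟩
      rw [ZMod.val_neg_of_ne_zero, Nat.cast_sub j.val_le]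
      ring
  rw [sum_sub_distrib, ← mul_sum, MulChar.sum_eq_zero_of_ne_one (inv_ne_one.2 hχ), mul_zero,
    zero_sub, ← firstMoment] at h1
  exact self_eq_neg.1 h1

/-- Parseval's identity for functions on the units modulo `N`. -/
theorem sum_norm_sq_sum_mul_inv (f : ZMod N → ℂ) :
    ∑ χ : DirichletCharacter ℂ N, ‖∑ j, f j * χ⁻¹ j‖ ^ 2 =
      N.totient * ∑ j with IsUnit j, ‖f j‖ ^ 2 := by
  rw [← Complex.ofReal_inj]
  push_cast
  simp only [← Complex.mul_conj']
  have h (χ : DirichletCharacter ℂ N) :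
      (∑ j, f j * χ⁻¹ j) * starRingEnd ℂ (∑ j, f j * χ⁻¹ j) =
        ∑ j with IsUnit j, ∑ k, f j * starRingEnd ℂ (f k) * (χ j⁻¹ * χ k) := by
    rw [map_sum, sum_mul_sum, sum_filter]
    refine sum_congr rfl fun j _ ↦ ?_
    split_ifs with hj
    · have hj' : χ⁻¹ j = χ j⁻¹ := by
        obtain ⟨u, rfl⟩ := hj
        rw [MulChar.inv_apply, Ring.inverse_unit, ZMod.inv_coe_unit]
      refine sum_congr rfl fun k _ ↦ ?_
      rw [map_mul, starRingEnd_apply (χ⁻¹ k), MulChar.star_apply', inv_inv, hj']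
      ring
    · simp [MulChar.map_nonunit _ hj]
  simp only [h]
  rw [sum_comm, mul_sum]
  refine sum_congr rfl fun j hj ↦ ?_
  rw [sum_comm]
  simp only [← mul_sum, sum_char_inv_mul_char_eq ℂ (mem_filter.1 hj).2]
  simp [mul_comm]

end DirichletCharacter

namespace Collision

open DirichletCharacter

theorem card_diagSet {b : ℕ} (hb : 0 < b) : #(diagSet b) = b := by
  conv_rhs => rw [← card_range b]
  symm
  refine card_bij' (fun i _ ↦ b * i + i) (fun n _ ↦ n % b) (fun i hi ↦ ?_) (fun n _ ↦ ?_)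
    (fun i hi ↦ ?_) (fun n hn ↦ ?_)
  · have hi' := mem_range.1 hi
    simp only [diagSet, mem_filter, mem_range, Nat.mul_add_mod, Nat.mul_add_div hb,
      Nat.mod_eq_of_lt hi', Nat.div_eq_of_lt hi', add_zero, and_true]
    nlinarith
  · exact mem_range.2 (Nat.mod_lt _ hb)
  · simp [Nat.mod_eq_of_lt (mem_range.1 hi)]
  · have h := (mem_filter.1 hn).2
    have h2 := Nat.div_add_mod n b
    rw [h] at h2
    exact h2

theorem card_cosetUnits {b a : ℕ} (hb : 0 < b) (ha : a.Coprime b) : #(cosetUnits b a) = b := by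
  conv_rhs => rw [← card_range b]
  have hr : a % b < b := Nat.mod_lt _ hb
  symm
  refine card_bij' (fun i _ ↦ b * i + a % b) (fun n _ ↦ n / b) (fun i hi ↦ ?_) (fun n hn ↦ ?_)
    (fun i _ ↦ ?_) (fun n hn ↦ ?_)
  · have hi' := mem_range.1 hi
    simp only [cosetUnits, mem_filter, mem_range, Nat.mul_add_mod, Nat.mod_mod, and_true]
    refine ⟨by nlinarith, Nat.Coprime.pow_right 2 ?_⟩
    rw [Nat.Coprime, Nat.gcd_comm, Nat.gcd_mul_left_add_right, Nat.gcd_comm, ← Nat.gcd_rec,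
      Nat.gcd_comm]
    exact ha
  · have h := mem_range.1 (mem_filter.1 hn).1
    exact mem_range.2 (Nat.div_lt_of_lt_mul (by rwa [← sq]))
  · simp [Nat.mul_add_div hb, Nat.div_eq_of_lt hr]
  · rw [← (mem_filter.1 hn).2.2]
    exact Nat.div_add_mod n b

theorem sum_range_eq_sum_zmod {N : ℕ} [NeZero N] {M : Type*} [AddCommMonoid M] (f : ℕ → M) :
    ∑ a ∈ range N, f a = ∑ j : ZMod N, f j.val := by
  refine sum_bij' (fun a _ ↦ (a : ZMod N)) (fun j _ ↦ j.val) (fun _ _ ↦ mem_univ _)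
    (fun j _ ↦ mem_range.2 j.val_lt) (fun a ha ↦ ZMod.val_cast_of_lt (mem_range.1 ha))
    (fun j _ ↦ ZMod.natCast_zmod_val j) fun a ha ↦ ?_
  rw [ZMod.val_cast_of_lt (mem_range.1 ha)]

theorem not_isUnit_base {b : ℕ} (hb : 1 < b) : ¬IsUnit ((b : ℕ) : ZMod (b ^ 2)) := by
  rw [ZMod.isUnit_iff_coprime]
  intro h
  exact hb.ne' ((Nat.coprime_self b).1 (Nat.Coprime.coprime_mul_right_right
    (k := b) (n := b) (by rwa [← sq])))

variable {b : ℕ} [NeZero (b ^ 2)] {χ : DirichletCharacter ℂ (b ^ 2)}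

/-- A primitive character is orthogonal to functions of the residue modulo `b`. -/
theorem sum_mod_mul_inv_eq_zero (hb : 1 < b) (hχ : χ.IsPrimitive) (f : ℕ → ℂ) :
    ∑ j : ZMod (b ^ 2), f (j.val % b) * χ⁻¹ j = 0 := by
  have h := hχ.sum_mul_inv_apply (fun k ↦ f (k.val / b)) (b : ZMod (b ^ 2))
  rw [MulChar.map_nonunit _ (not_isUnit_base hb), zero_mul] at h
  rw [← h]
  refine sum_congr rfl fun j _ ↦ ?_
  have hj : ((b : ZMod (b ^ 2)) * j).val = b * (j.val % b) := by
    conv_lhs => rw [← ZMod.natCast_zmod_val j, ← Nat.cast_mul, ZMod.val_natCast]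
    generalize j.val = v
    rw [sq, Nat.mul_mod_mul_left]
  simp only [hj, Nat.mul_div_cancel_left _ (Nat.zero_lt_of_lt hb)]

theorem ne_one_of_isPrimitive (hb : 1 < b) (hχ : χ.IsPrimitive) : χ ≠ 1 := by
  rintro rfl
  rw [isPrimitive_def, conductor_one] at hχ
  nlinarith

theorem sum_floor_mul_inv (hχ : χ.IsPrimitive) (n : ℕ) :
    (b : ℂ) ^ 2 * ∑ j : ZMod (b ^ 2), ((n * j.val / b ^ 2 : ℕ) : ℂ) * χ⁻¹ j =
      (n - χ n) * firstMoment χ := by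
  have h := hχ.sum_mul_inv_apply (fun k ↦ (k.val : ℂ)) (n : ZMod (b ^ 2))
  rw [sub_mul, firstMoment, ← h, mul_sum, mul_sum, ← sum_sub_distrib]
  refine sum_congr rfl fun j _ ↦ ?_
  have hj : ((n : ZMod (b ^ 2)) * j).val = (n * j.val) % b ^ 2 := by
    conv_lhs => rw [← ZMod.natCast_zmod_val j, ← Nat.cast_mul, ZMod.val_natCast]
  have h2 : (b : ℂ) ^ 2 * ((n * j.val / b ^ 2 : ℕ) : ℂ) + ((n * j.val % b ^ 2 : ℕ) : ℂ) =
      n * j.val := by exact_mod_cast Nat.div_add_mod (n * j.val) (b ^ 2)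
  simp only [hj]
  linear_combination χ⁻¹ j * h2

theorem sum_div_mul_inv (hb : 1 < b) (hχ : χ.IsPrimitive) :
    (b : ℂ) * ∑ j : ZMod (b ^ 2), ((j.val / b : ℕ) : ℂ) * χ⁻¹ j = firstMoment χ := by
  have h := sum_mod_mul_inv_eq_zero hb hχ (fun r ↦ (r : ℂ))
  rw [← sub_zero (firstMoment χ), ← h, firstMoment, mul_sum, ← sum_sub_distrib]
  refine sum_congr rfl fun j _ ↦ ?_
  have h2 : (b : ℂ) * ((j.val / b : ℕ) : ℂ) + ((j.val % b : ℕ) : ℂ) = j.val := by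
    exact_mod_cast Nat.div_add_mod j.val b
  linear_combination χ⁻¹ j * h2

theorem sum_S_mul_inv (hb : 1 < b) (hχ : χ.IsPrimitive) :
    (b : ℂ) ^ 2 * ∑ j : ZMod (b ^ 2), (S b j.val : ℂ) * χ⁻¹ j =
      -(firstMoment χ * starRingEnd ℂ (SG b χ)) := by
  have h1 : ∑ j : ZMod (b ^ 2), χ⁻¹ j = 0 :=
    MulChar.sum_eq_zero_of_ne_one (inv_ne_one.2 (ne_one_of_isPrimitive hb hχ))
  have h2 (n : ℕ) : (b : ℂ) ^ 2 * ∑ j : ZMod (b ^ 2), (d b n j.val : ℂ) * χ⁻¹ j =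
      (1 - (χ ((n + 1 : ℕ) : ZMod (b ^ 2)) - χ n)) * firstMoment χ := by
    have h3 := sum_floor_mul_inv hχ (n + 1)
    have h4 := sum_floor_mul_inv hχ n
    simp only [d, Int.cast_sub, Int.cast_natCast, sub_mul, sum_sub_distrib, mul_sub]
    rw [h3, h4]
    push_cast
    ring
  have h5 : (b : ℂ) ^ 2 * ∑ j : ZMod (b ^ 2), (∑ n ∈ diagSet b, (d b n j.val : ℂ)) * χ⁻¹ j =
      (b - starRingEnd ℂ (SG b χ)) * firstMoment χ := by
    simp only [sum_mul]
    rw [sum_comm, mul_sum, sum_congr rfl fun n _ ↦ h2 n, ← sum_mul, sum_sub_distrib, sum_const,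
      card_diagSet (Nat.zero_lt_of_lt hb), SG, map_sum]
    simp
  have h6 := sum_div_mul_inv hb hχ
  have h7 (j : ZMod (b ^ 2)) : (S b j.val : ℂ) * χ⁻¹ j =
      (∑ n ∈ diagSet b, (d b n j.val : ℂ)) * χ⁻¹ j - χ⁻¹ j -
        ((j.val / b : ℕ) : ℂ) * χ⁻¹ j := by
    simp only [S, Int.cast_add, Int.cast_sub, Int.cast_sum, Int.cast_natCast, Int.cast_neg,
      Int.cast_one]
    ring
  rw [sum_congr rfl fun j _ ↦ h7 j, sum_sub_distrib, sum_sub_distrib, h1]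
  linear_combination h5 - b * h6

theorem sum_Scirc_mul_inv (hb : 1 < b) (hχ : χ.IsPrimitive) :
    ∑ j : ZMod (b ^ 2), (Scirc b j.val : ℂ) * χ⁻¹ j =
      ∑ j : ZMod (b ^ 2), (S b j.val : ℂ) * χ⁻¹ j := by
  have h := sum_mod_mul_inv_eq_zero hb hχ (fun r ↦ 1 / (b : ℂ) *
    ∑ a ∈ (range (b ^ 2)).filter (fun a ↦ Nat.gcd a (b ^ 2) = 1 ∧ a % b = r), (S b a : ℂ))
  rw [← sub_zero (∑ j : ZMod (b ^ 2), (S b j.val : ℂ) * χ⁻¹ j), ← h, ← sum_sub_distrib]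
  refine sum_congr rfl fun j _ ↦ ?_
  simp only [Scirc, cosetUnits]
  push_cast
  ring

theorem sum_Scirc_mul_inv_eq_zero (hb : b.Prime) (hχ : ¬χ.IsPrimitive) :
    ∑ j : ZMod (b ^ 2), (Scirc b j.val : ℂ) * χ⁻¹ j = 0 := by
  have hb0 : (b : ℂ) ≠ 0 := Nat.cast_ne_zero.2 hb.ne_zero
  have hcond : χ⁻¹.conductor ∣ b := by
    rw [conductor_inv]
    obtain ⟨k, hk, hkc⟩ := (Nat.dvd_prime_pow hb).1 χ.conductor_dvd_level
    have hk1 : k ≤ 1 := by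
      by_contra hlt
      exact hχ (by rw [isPrimitive_def, hkc, show k = 2 by omega])
    rw [hkc]
    simpa using pow_dvd_pow b hk1
  obtain ⟨hdvd, ψ, hψ⟩ := FactorsThrough.mono χ⁻¹ χ⁻¹.factorsThrough_conductor hcond
    (dvd_pow_self b two_ne_zero)
  have hunit {a : ℕ} (ha : Nat.gcd a (b ^ 2) = 1) : χ⁻¹ (a : ZMod (b ^ 2)) = ψ (a : ZMod b) := by
    have := changeLevel_eq_cast_of_dvd ψ hdvd (ZMod.unitOfCoprime a ha)
    rw [hψ]
    simpa using this
  have hnonunit {a : ℕ} (ha : ¬Nat.gcd a (b ^ 2) = 1) : χ⁻¹ (a : ZMod (b ^ 2)) = 0 :=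
    MulChar.map_nonunit _ fun h ↦ ha ((ZMod.isUnit_iff_coprime _ _).1 h)
  have hrange : ∑ j : ZMod (b ^ 2), (Scirc b j.val : ℂ) * χ⁻¹ j =
      ∑ a ∈ (range (b ^ 2)).filter (fun a ↦ Nat.gcd a (b ^ 2) = 1),
        (Scirc b a : ℂ) * ψ (a : ZMod b) := by
    have := sum_range_eq_sum_zmod (N := b ^ 2)
      (fun a ↦ (Scirc b a : ℂ) * χ⁻¹ (a : ZMod (b ^ 2)))
    simp only [ZMod.natCast_zmod_val] at this
    rw [← this, sum_filter]
    refine sum_congr rfl fun a _ ↦ ?_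
    split_ifs with ha
    · rw [hunit ha]
    · rw [hnonunit ha, mul_zero]
  have hmean : ∑ a ∈ (range (b ^ 2)).filter (fun a ↦ Nat.gcd a (b ^ 2) = 1),
      (∑ a' ∈ cosetUnits b a, (S b a' : ℂ)) * ψ (a : ZMod b) =
      b * ∑ a ∈ (range (b ^ 2)).filter (fun a ↦ Nat.gcd a (b ^ 2) = 1),
        (S b a : ℂ) * ψ (a : ZMod b) := by
    simp only [sum_mul, mul_sum]
    rw [sum_comm' (t' := (range (b ^ 2)).filter (fun a ↦ Nat.gcd a (b ^ 2) = 1))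
      (s' := fun a ↦ cosetUnits b a)]
    · refine sum_congr rfl fun a ha ↦ ?_
      have hab : a.Coprime b := Nat.Coprime.coprime_mul_right_right (k := b) (n := b)
        (by rw [← sq]; exact (mem_filter.1 ha).2)
      rw [sum_congr rfl (g := fun _ ↦ (S b a : ℂ) * ψ (a : ZMod b)), sum_const,
        card_cosetUnits hb.pos hab, nsmul_eq_mul]
      intro a' ha'
      rw [(ZMod.natCast_eq_natCast_iff' a' a b).2 (mem_filter.1 ha').2.2]
    · intro a a'
      simp only [cosetUnits, mem_filter]
      constructor
      · rintro ⟨⟨h1, h2⟩, h3, h4, h5⟩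
        exact ⟨⟨h1, h2, h5.symm⟩, h3, h4⟩
      · rintro ⟨⟨h1, h2, h5⟩, h3, h4⟩
        exact ⟨⟨h1, h2⟩, h3, h4, h5.symm⟩
  rw [hrange]
  simp only [Scirc]
  push_cast
  simp only [sub_mul, sum_sub_distrib, mul_assoc]
  rw [← mul_sum, hmean]
  field_simp
  ring

theorem norm_sq_sum_Scirc_mul_inv (hb : 1 < b) (hχ : χ.IsPrimitive) :
    ‖∑ j : ZMod (b ^ 2), (Scirc b j.val : ℂ) * χ⁻¹ j‖ ^ 2 =
      ‖firstMoment χ‖ ^ 2 * ‖SG b χ‖ ^ 2 / b ^ 4 := by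
  have hb0 : (b : ℝ) ≠ 0 := Nat.cast_ne_zero.2 (Nat.ne_zero_of_lt hb)
  have h := congrArg (‖·‖ ^ 2) (sum_S_mul_inv hb hχ)
  simp only [norm_mul, norm_neg, norm_pow, mul_pow, RCLike.norm_conj, Complex.norm_natCast] at h
  rw [sum_Scirc_mul_inv hb hχ, eq_div_iff (pow_ne_zero 4 hb0)]
  linear_combination h

end Collision

open Collision in
theorem stmt3 (b : ℕ) (hb : b.Prime) :
    haveI : NeZero (b ^ 2) := ⟨pow_ne_zero 2 hb.ne_zero⟩
    ∑ χ ∈ Finset.univ.filter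
        (fun χ : DirichletCharacter ℂ (b ^ 2) => χ.IsPrimitive ∧ χ.Odd),
        ‖DirichletCharacter.LFunction χ 1‖ ^ 2 * ‖SG b χ‖ ^ 2
      = Real.pi ^ 2 * (Nat.totient (b ^ 2) : ℝ) / ((b : ℝ) ^ 2) *
          ∑ a ∈ (Finset.range (b ^ 2)).filter (fun a => Nat.gcd a (b ^ 2) = 1),
            |Scirc b a| ^ 2 := by
  have : NeZero (b ^ 2) := ⟨pow_ne_zero 2 hb.ne_zero⟩
  have hb0 : (b : ℝ) ≠ 0 := Nat.cast_ne_zero.2 hb.ne_zero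
  have hunits : ∑ a ∈ (Finset.range (b ^ 2)).filter (fun a => Nat.gcd a (b ^ 2) = 1),
      |Scirc b a| ^ 2 =
      ∑ j : ZMod (b ^ 2) with IsUnit j, ‖(Scirc b j.val : ℂ)‖ ^ 2 := by
    rw [sum_filter, sum_filter, sum_range_eq_sum_zmod]
    refine sum_congr rfl fun j _ ↦ ?_
    have hj : Nat.gcd j.val (b ^ 2) = 1 ↔ IsUnit j := by
      rw [← Nat.coprime_iff_gcd_eq_one, ← ZMod.isUnit_iff_coprime, ZMod.natCast_zmod_val]
    simp only [hj, Complex.norm_real, Real.norm_eq_abs]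
  have hpars := DirichletCharacter.sum_norm_sq_sum_mul_inv
    (fun j : ZMod (b ^ 2) ↦ (Scirc b j.val : ℂ))
  rw [hunits, mul_div_right_comm, mul_assoc, ← hpars, mul_sum, sum_filter]
  refine sum_congr rfl fun χ _ ↦ ?_
  split_ifs with h
  · rw [h.1.norm_LFunction_one_sq h.2, norm_sq_sum_Scirc_mul_inv hb.one_lt h.1]
    push_cast
    field_simp
  · by_cases hχ : χ.IsPrimitive
    · have heven : χ.Even := χ.even_or_odd.resolve_right fun ho ↦ h ⟨hχ, ho⟩
      rw [norm_sq_sum_Scirc_mul_inv hb.one_lt hχ,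
        heven.firstMoment_eq_zero (ne_one_of_isPrimitive hb.one_lt hχ)]
      simp
    · rw [sum_Scirc_mul_inv_eq_zero hb hχ]
      simp
end

section
/- For every prime b ∈ {2, 3, 5, 7, 11, 13} and every primitive odd Dirichlet character χ modulo b², the diagonal character sum satisfies |S_G(χ)| = 2·|Σ_{k=1}^{b−1} χ̄(k)|. -/
open Finset
open scoped Classical

namespace Collision

lemma diagSet_eq_image {b : ℕ} (hb : 0 < b) :
    diagSet b = (Finset.range b).image (fun k => k * (b + 1)) := by
  ext n
  simp only [diagSet, Finset.mem_filter, Finset.mem_range, Finset.mem_image]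
  constructor
  · rintro ⟨-, h⟩
    refine ⟨n % b, Nat.mod_lt _ hb, ?_⟩
    have := Nat.div_add_mod n b
    rw [h] at this
    linarith
  · rintro ⟨k, hk, rfl⟩
    have e : k * (b + 1) = k + b * k := by ring
    refine ⟨by nlinarith, ?_⟩
    rw [e, Nat.add_mul_div_left _ _ hb, Nat.add_mul_mod_self_left, Nat.div_eq_of_lt hk,
      Nat.mod_eq_of_lt hk, zero_add]

lemma sum_diagSet {M : Type*} [AddCommMonoid M] {b : ℕ} (hb : 0 < b) (f : ℕ → M) :
    ∑ n ∈ diagSet b, f n = ∑ k ∈ Finset.range b, f (k * (b + 1)) := by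
  rw [diagSet_eq_image hb, Finset.sum_image]
  intro x _ y _ h
  exact Nat.eq_of_mul_eq_mul_right (Nat.succ_pos b) h

/-- Reflecting `k ↦ b - 1 - k` sends `n + 1` to `-n` modulo `b²` along the diagonal. -/
lemma reflect_diag_succ_cast {b k : ℕ} (hk : k < b) :
    (((b - 1 - k) * (b + 1) + 1 : ℕ) : ZMod (b ^ 2)) = -((k * (b + 1) : ℕ) : ZMod (b ^ 2)) := by
  rw [eq_neg_iff_add_eq_zero, ← Nat.cast_add]
  obtain ⟨j, rfl⟩ : ∃ j, b = k + 1 + j := ⟨b - (k + 1), by omega⟩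
  have hj : k + 1 + j - 1 - k = j := by omega
  have e : j * (k + 1 + j + 1) + 1 + k * (k + 1 + j + 1) = (k + 1 + j) ^ 2 := by ring
  rw [hj, e, ZMod.natCast_self]

/-- For odd `χ`, the diagonal sum is `-2 χ̄(b + 1)` times the sum of `χ̄` over `0 ≤ k < b`. -/
lemma SG_eq_of_odd {b : ℕ} (hb : 0 < b) {χ : DirichletCharacter ℂ (b ^ 2)} (hodd : χ.Odd) :
    SG b χ = -2 * starRingEnd ℂ (χ ((b + 1 : ℕ) : ZMod (b ^ 2))) *
      ∑ k ∈ Finset.range b, starRingEnd ℂ (χ (k : ZMod (b ^ 2))) := by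
  have hmul : ∀ k : ℕ, starRingEnd ℂ (χ ((k * (b + 1) : ℕ) : ZMod (b ^ 2))) =
      starRingEnd ℂ (χ ((b + 1 : ℕ) : ZMod (b ^ 2))) *
        starRingEnd ℂ (χ (k : ZMod (b ^ 2))) := fun k => by
    rw [Nat.cast_mul, map_mul, map_mul, mul_comm]
  have hsucc : ∑ k ∈ Finset.range b,
      starRingEnd ℂ (χ ((k * (b + 1) + 1 : ℕ) : ZMod (b ^ 2))) =
      -∑ k ∈ Finset.range b, starRingEnd ℂ (χ ((k * (b + 1) : ℕ) : ZMod (b ^ 2))) := by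
    rw [← Finset.sum_range_reflect, ← Finset.sum_neg_distrib]
    refine Finset.sum_congr rfl fun k hk => ?_
    rw [reflect_diag_succ_cast (Finset.mem_range.mp hk), hodd.eval_neg, map_neg]
  rw [SG, sum_diagSet hb, Finset.sum_sub_distrib, hsucc]
  simp only [hmul, ← Finset.mul_sum]
  ring

end Collision

open Collision in
theorem stmt15 (b : ℕ) (hb : b.Prime) (hmem : b ∈ ({2, 3, 5, 7, 11, 13} : Finset ℕ))
    (χ : DirichletCharacter ℂ (b ^ 2)) (hprim : χ.IsPrimitive) (hodd : χ.Odd) :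
    ‖SG b χ‖
      = 2 * ‖∑ k ∈ Finset.Icc 1 (b - 1), starRingEnd ℂ (χ (k : ZMod (b ^ 2)))‖ := by
  have hcop : (b + 1).Coprime (b ^ 2) := Nat.Coprime.pow_right 2 (by simp)
  have hnorm : ‖χ ((b + 1 : ℕ) : ZMod (b ^ 2))‖ = 1 := by
    rw [← ZMod.coe_unitOfCoprime _ hcop]
    exact χ.unit_norm_eq_one _
  have : Fact (1 < b ^ 2) := ⟨Nat.one_lt_pow two_ne_zero hb.one_lt⟩
  have hrange : ∑ k ∈ Finset.range b, starRingEnd ℂ (χ (k : ZMod (b ^ 2))) =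
      ∑ k ∈ Finset.Icc 1 (b - 1), starRingEnd ℂ (χ (k : ZMod (b ^ 2))) := by
    symm
    refine Finset.sum_subset (fun k hk => ?_) fun k hk hk' => ?_
    · simp only [Finset.mem_Icc, Finset.mem_range] at hk ⊢
      omega
    · simp only [Finset.mem_Icc, Finset.mem_range] at hk hk'
      obtain rfl : k = 0 := by omega
      rw [Nat.cast_zero, χ.map_nonunit not_isUnit_zero, map_zero]
  rw [SG_eq_of_odd hb.pos hodd, hrange, norm_mul, norm_mul, RCLike.norm_conj, hnorm]
  simp
end
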